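/- Let X be a Polish space and let S : ℕ^{<ω} → 𝒫(X) be a family of sets indexed by finite sequences of natural numbers such that S(σ) is an EBP-set for every finite sequence σ. Then the result of the Alexandrov–Suslin operation, 𝒜(S) = ⋃_{w ∈ ℕ^ℕ} ⋂_{n ∈ ℕ} S(w↾n), is an EBP-set. -/

import Mathlib

open MeasureTheory Set Topology
open scoped ENNReal symmDiff

/-- The annihilator of a set `A`: the set of Borel probability measures `μ` on `X`
whose induced outer measure vanishes on `A`. -/
def Annihilator {X : Type*} [MeasurableSpace X] (A : Set X) :
    Set (ProbabilityMeasure X) :=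
  {μ : ProbabilityMeasure X | μ.toMeasure A = 0}

/-- `A` is residually null if its annihilator is comeager in the space `𝓜(X)` of
Borel probability measures with the topology of weak convergence. -/
def ResiduallyNull {X : Type*} [TopologicalSpace X] [MeasurableSpace X]
    [OpensMeasurableSpace X] (A : Set X) : Prop :=
  Annihilator A ∈ residual (ProbabilityMeasure X)

/-- `A` is an EBP-set (extended Baire property) if its symmetric difference with some
open set is residually null. -/
def EBPSet {X : Type*} [TopologicalSpace X] [MeasurableSpace X]
    [OpensMeasurableSpace X] (A : Set X) : Prop :=
  ∃ U : Set X, IsOpen U ∧ ResiduallyNull (A ∆ U)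

open Filter

/-- **Marczewski's theorem**: a σ-algebra in which every set has a measurable hull, up to
hereditarily measurable sets, is closed under the Alexandrov–Suslin operation. -/
theorem MeasurableSet.suslin_of_exists_hull {X : Type*} [MeasurableSpace X]
    (hull : ∀ A : Set X, ∃ H, A ⊆ H ∧ MeasurableSet H ∧
      ∀ B ⊆ H \ A, MeasurableSet B → ∀ C ⊆ B, MeasurableSet C)
    (S : ∀ n : ℕ, (Fin n → ℕ) → Set X) (hS : ∀ n σ, MeasurableSet (S n σ)) :
    MeasurableSet (⋃ w : ℕ → ℕ, ⋂ n : ℕ, S n fun i : Fin n => w i) := by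
  choose hull sub_hull measurable_hull hull_diff using hull
  let A : ∀ n : ℕ, (Fin n → ℕ) → Set X := fun n σ =>
    {x | ∃ w : ℕ → ℕ, (fun i : Fin n => w i) = σ ∧ ∀ m, x ∈ S m fun i : Fin m => w i}
  let H : ∀ n : ℕ, (Fin n → ℕ) → Set X := fun n σ => hull (A n σ) ∩ S n σ
  have hH : ∀ n σ, MeasurableSet (H n σ) := fun n σ => (measurable_hull _).inter (hS n σ)
  have hAH : ∀ n σ, A n σ ⊆ H n σ := by
    refine fun n σ x hx => ⟨sub_hull _ hx, ?_⟩
    obtain ⟨w, rfl, hw⟩ := hx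
    exact hw n
  have snoc_eq : ∀ (n : ℕ) (w : ℕ → ℕ), (Fin.snoc (fun i : Fin n => w i) (w n) : Fin (n + 1) → ℕ)
      = fun i : Fin (n + 1) => w i := by
    intro n w
    ext i
    refine Fin.lastCases ?_ (fun j => ?_) i <;> simp
  let C : ∀ n : ℕ, (Fin n → ℕ) → Set X := fun n σ => H n σ \ ⋃ k : ℕ, H (n + 1) (Fin.snoc σ k)
  have hC : ∀ n σ, ∀ D ⊆ C n σ, MeasurableSet D := by
    refine fun n σ => hull_diff (A n σ) _ ?_ ((hH n σ).diff (.iUnion fun k => hH _ _))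
    refine fun x hx => ⟨hx.1.1, fun ⟨w, hw, hx'⟩ => hx.2 (mem_iUnion.2 ⟨w n, hAH _ _ ⟨w, ?_, hx'⟩⟩)⟩
    rw [← hw, snoc_eq]
  set T := ⋃ w : ℕ → ℕ, ⋂ n : ℕ, S n fun i : Fin n => w i with hT
  have hAT : A 0 Fin.elim0 = T := by
    ext x
    simp only [A, hT, mem_ofPred_eq, mem_iUnion, mem_iInter]
    exact exists_congr fun w => and_iff_right (Subsingleton.elim _ _)
  have hTH : T ⊆ H 0 Fin.elim0 := hAT ▸ hAH 0 _
  have hcover : H 0 Fin.elim0 \ T ⊆ ⋃ n, ⋃ σ, C n σ := by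
    rintro x ⟨hx, hxT⟩
    by_contra hxC
    have step : ∀ n σ, ∃ k : ℕ, x ∈ H n σ → x ∈ H (n + 1) (Fin.snoc σ k) := by
      intro n σ
      by_contra! h
      refine hxC (mem_iUnion₂.2 ⟨n, σ, (h 0).1, ?_⟩)
      rw [mem_iUnion]
      rintro ⟨k, hk⟩
      exact (h k).2 hk
    choose next hnext using step
    let t : ∀ n : ℕ, Fin n → ℕ := fun n =>
      Nat.rec (motive := fun n => Fin n → ℕ) Fin.elim0 (fun n σ => Fin.snoc σ (next n σ)) n
    have ht : ∀ n, t n = fun i : Fin n => next i (t i) := by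
      intro n
      induction n with
      | zero => exact Subsingleton.elim _ _
      | succ n ih =>
        rw [← snoc_eq n fun m => next m (t m), ← ih]
    have hxt : ∀ n, x ∈ H n (t n) := by
      intro n
      induction n with
      | zero => exact hx
      | succ n ih => exact hnext n _ ih
    refine hxT (mem_iUnion.2 ⟨fun n => next n (t n), mem_iInter.2 fun n => ?_⟩)
    exact ht n ▸ (hxt n).2
  have hdiff : H 0 Fin.elim0 \ T = ⋃ n, ⋃ σ, (H 0 Fin.elim0 \ T) ∩ C n σ := by
    simpa only [inter_iUnion] using (inter_eq_left.2 hcover).symm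
  rw [← sdiff_sdiff_eq_self hTH, hdiff]
  exact (hH _ _).diff (.iUnion fun n => .iUnion fun σ => hC n σ _ inter_subset_right)

section ResiduallyNull

variable {X : Type*} [TopologicalSpace X] [MeasurableSpace X] {A B : Set X}

theorem ResiduallyNull.mono [OpensMeasurableSpace X] (hB : ResiduallyNull B) (h : A ⊆ B) :
    ResiduallyNull A :=
  mem_of_superset hB fun _ hμ => measure_mono_null h hμ

theorem ResiduallyNull.sUnion [OpensMeasurableSpace X] {𝒮 : Set (Set X)} (hc : 𝒮.Countable)
    (h : ∀ A ∈ 𝒮, ResiduallyNull A) : ResiduallyNull (⋃₀ 𝒮) :=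
  mem_of_superset ((countable_bInter_mem hc).2 h) fun _ hμ =>
    (measure_sUnion_null_iff hc).2 fun A hA => mem_iInter₂.1 hμ A hA

variable (X) in
/-- The σ-filter of complements of residually null sets. -/
def residuallyNullDual [OpensMeasurableSpace X] : Filter X :=
  Filter.ofCountableUnion {A | ResiduallyNull A} (fun _ => ResiduallyNull.sUnion)
    fun _ ht _ => ResiduallyNull.mono ht

instance [OpensMeasurableSpace X] : CountableInterFilter (residuallyNullDual X) :=
  countableInter_ofCountableUnion ..

theorem eventuallyEq_residuallyNullDual [OpensMeasurableSpace X] :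
    A =ᶠ[residuallyNullDual X] B ↔ ResiduallyNull (A ∆ B) := by
  rw [eventuallyEq_set, Filter.Eventually, residuallyNullDual, mem_ofCountableUnion, mem_ofPred_eq]
  congr! 1
  ext x
  simp only [mem_compl_iff, mem_ofPred_eq, mem_symmDiff]
  tauto

/-- The measures concentrated on the complement of a set with dense complement are dense. -/
theorem dense_annihilator_compl [PolishSpace X] [BorelSpace X] (hA : MeasurableSet A)
    (hd : Dense A) : Dense (Annihilator Aᶜ) := by
  let := TopologicalSpace.metrizableSpaceMetric X
  intro μ
  have : Nonempty X := nonempty_of_isProbabilityMeasure (μ : Measure X)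
  obtain ⟨y, hy⟩ := hd.nonempty
  let T := SimpleFunc.approxOn id measurable_id A y hy
  have hT : ∀ n, AEMeasurable (T n) (μ : Measure X) := fun n => (T n).measurable.aemeasurable
  refine mem_closure_of_tendsto (f := fun n => μ.map (hT n)) (b := atTop) ?_
    (Eventually.of_forall fun n => ?_)
  · rw [ProbabilityMeasure.tendsto_iff_forall_integral_tendsto]
    intro f
    have hmap : ∀ n, ∫ x, f x ∂(μ.map (hT n) : Measure X) = ∫ x, f (T n x) ∂(μ : Measure X) :=
      fun n => integral_map (hT n) f.continuous.aestronglyMeasurable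
    simp only [hmap]
    refine tendsto_integral_of_dominated_convergence (fun _ => ‖f‖)
      (fun n => (f.continuous.measurable.comp (T n).measurable).aestronglyMeasurable)
      (integrable_const _) (fun n => .of_forall fun x => f.norm_coe_le_norm _)
      (.of_forall fun x => (f.continuous.tendsto _).comp ?_)
    exact SimpleFunc.tendsto_approxOn measurable_id hy (hd x)
  · change (μ : Measure X).map (T n) Aᶜ = 0
    rw [Measure.map_apply (T n).measurable hA.compl]
    convert measure_empty (μ := (μ : Measure X))
    ext x
    simpa using SimpleFunc.approxOn_mem measurable_id hy n x

theorem isOpen_setOf_lt_measure [PolishSpace X] [BorelSpace X] {U : Set X} (hU : IsOpen U)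
    (c : ℝ≥0∞) : IsOpen {μ : ProbabilityMeasure X | c < (μ : Measure X) U} := by
  let := TopologicalSpace.metrizableSpaceMetric X
  refine isOpen_iff_mem_nhds.2 fun μ hμ => ?_
  exact eventually_lt_of_lt_liminf
    (lt_of_lt_of_le hμ (ProbabilityMeasure.le_liminf_measure_open_of_tendsto tendsto_id hU))

theorem residuallyNull_compl_of_isOpen_of_dense [PolishSpace X] [BorelSpace X] {U : Set X}
    (hU : IsOpen U) (hd : Dense U) : ResiduallyNull Uᶜ := by
  have hmem : ∀ n : ℕ, {μ : ProbabilityMeasure X | 1 - (n : ℝ≥0∞)⁻¹ < (μ : Measure X) U} ∈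
      residual (ProbabilityMeasure X) := fun n => by
    refine residual_of_dense_open (isOpen_setOf_lt_measure hU _)
      ((dense_annihilator_compl hU.measurableSet hd).mono fun μ hμ => ?_)
    have hμU : (μ : Measure X) U = 1 := (prob_compl_eq_zero_iff hU.measurableSet).1 hμ
    rw [mem_ofPred_eq, hμU]
    exact ENNReal.sub_lt_self ENNReal.one_ne_top one_ne_zero (by simp)
  refine mem_of_superset (countable_iInter_mem.2 hmem) fun μ hμ => ?_
  refine (prob_compl_eq_zero_iff hU.measurableSet).2 (le_antisymm prob_le_one ?_)
  have hlim : Tendsto (fun n : ℕ => 1 - (n : ℝ≥0∞)⁻¹) atTop (𝓝 (1 - 0)) :=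
    ENNReal.Tendsto.sub tendsto_const_nhds ENNReal.tendsto_inv_nat_nhds_zero (by simp)
  rw [tsub_zero] at hlim
  exact le_of_tendsto' hlim fun n => (mem_iInter.1 hμ n).le

theorem residuallyNullDual_le_residual [PolishSpace X] [BorelSpace X] :
    residuallyNullDual X ≤ residual X :=
  le_countableGenerate_iff_of_countableInterFilter.mpr fun _ ht =>
    residuallyNull_compl_of_isOpen_of_dense ht.1 ht.2

theorem eventuallyMeasurableSet_residuallyNullDual [PolishSpace X] [BorelSpace X] :
    EventuallyMeasurableSet ‹_› (residuallyNullDual X) A ↔ EBPSet A := by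
  constructor
  · rintro ⟨t, ht, hAt⟩
    obtain ⟨U, hU, htU⟩ := ht.residualEq_isOpen
    exact ⟨U, hU, eventuallyEq_residuallyNullDual.1
      (hAt.trans (htU.filter_mono residuallyNullDual_le_residual))⟩
  · rintro ⟨U, hU, hAU⟩
    exact ⟨U, hU.measurableSet, eventuallyEq_residuallyNullDual.2 hAU⟩

theorem ResiduallyNull.ebpSet [OpensMeasurableSpace X] (hA : ResiduallyNull A) : EBPSet A :=
  ⟨∅, isOpen_empty, hA.mono (symmDiff_bot A).le⟩

/-- There is a largest open set whose intersection with `A` is residually null. -/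
theorem exists_isOpen_residuallyNull_inter [SecondCountableTopology X] [OpensMeasurableSpace X]
    (A : Set X) : ∃ U, IsOpen U ∧ ResiduallyNull (A ∩ U) ∧
      ∀ V, IsOpen V → ResiduallyNull (A ∩ V) → V ⊆ U := by
  let 𝒰 := {u ∈ TopologicalSpace.countableBasis X | ResiduallyNull (A ∩ u)}
  have hbasis := TopologicalSpace.isBasis_countableBasis X
  refine ⟨⋃₀ 𝒰, isOpen_sUnion fun u hu => hbasis.isOpen hu.1, ?_, fun V hV hAV x hx => ?_⟩
  · refine (ResiduallyNull.sUnion (𝒮 := (A ∩ ·) '' 𝒰) ?_ ?_).mono ?_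
    · exact ((TopologicalSpace.countable_countableBasis X).mono (sep_subset _ _)).image _
    · rintro _ ⟨u, hu, rfl⟩
      exact hu.2
    · rintro x ⟨hxA, u, hu, hxu⟩
      exact ⟨_, mem_image_of_mem _ hu, hxA, hxu⟩
  · obtain ⟨u, hu, hxu, huV⟩ := hbasis.exists_subset_of_mem_open hx hV
    exact ⟨u, ⟨hu, hAV.mono (inter_subset_inter_right A huV)⟩, hxu⟩

theorem exists_ebpSet_hull [PolishSpace X] [BorelSpace X] (A : Set X) :
    ∃ H, A ⊆ H ∧ EBPSet H ∧ ∀ B ⊆ H \ A, EBPSet B → ResiduallyNull B := by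
  obtain ⟨U, hU, hAU, hmax⟩ := exists_isOpen_residuallyNull_inter A
  refine ⟨A ∪ Uᶜ, subset_union_left, ?_, ?_⟩
  · rw [← eventuallyMeasurableSet_residuallyNullDual]
    refine hU.measurableSet.compl.eventuallyMeasurableSet.congr
      (eventuallyEq_residuallyNullDual.2 (hAU.mono ?_))
    intro x
    simp only [mem_symmDiff, mem_union, mem_compl_iff, mem_inter_iff]
    tauto
  · rintro B hB ⟨V, hV, hBV⟩
    have hVU : V ⊆ U := hmax V hV <| hBV.mono fun x hx => Or.inr ⟨hx.2, fun hxB => (hB hxB).2 hx.1⟩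
    refine hBV.mono fun x hx => Or.inl ⟨hx, fun hxV => ?_⟩
    exact (hB hx).1.elim (hB hx).2 fun h => h (hVU hxV)

end ResiduallyNull

/-- The class of EBP-sets is closed under the Alexandrov–Suslin operation. -/
theorem ebp_closed_under_suslin_operation {X : Type*} [TopologicalSpace X] [PolishSpace X]
    [MeasurableSpace X] [BorelSpace X] (S : ∀ n : ℕ, (Fin n → ℕ) → Set X)
    (hS : ∀ (n : ℕ) (σ : Fin n → ℕ), EBPSet (S n σ)) :
    EBPSet (⋃ w : ℕ → ℕ, ⋂ n : ℕ, S n fun i : Fin n => w i) := by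
  rw [← eventuallyMeasurableSet_residuallyNullDual]
  refine @MeasurableSet.suslin_of_exists_hull X (eventuallyMeasurableSpace _ _) (fun A => ?_) S
    fun n σ => eventuallyMeasurableSet_residuallyNullDual.2 (hS n σ)
  obtain ⟨H, hAH, hH, hnull⟩ := exists_ebpSet_hull A
  exact ⟨H, hAH, eventuallyMeasurableSet_residuallyNullDual.2 hH, fun B hB hBm C hCB =>
    eventuallyMeasurableSet_residuallyNullDual.2 ((hnull B hB
      (eventuallyMeasurableSet_residuallyNullDual.1 hBm)).mono hCB).ebpSet⟩
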